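/- arXiv:2605.26535 — 3 statements merged into one kernel-verified Lean document; each statement's English description precedes it below -/
import Mathlib

section
/- Let E be a real Banach space, L > 0 and M ≥ 0 real numbers, and v : E → ℝ → E a time-dependent vector field such that for every t ∈ [0,1] the map x ↦ v x t is Lipschitz with constant L. Let ψ : ℝ → E be twice differentiable on [0,1] with ψ'(t) = v (ψ t) t and ‖ψ''(t)‖ ≤ M for all t ∈ [0,1]. Fix an integer K ≥ 1, set h = 1/K and t_k = k·h, and define the Euler iterates x_0 = ψ 0 and x_{k+1} = x_k + h • v x_k t_k for 0 ≤ k < K. Then ‖ψ 1 − x_K‖ ≤ (h/2) · ((Real.exp L − 1)/L) · M. -/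
theorem euler_local_error
    {E : Type*} [NormedAddCommGroup E] [NormedSpace ℝ E]
    (M : ℝ) (ψ ψ' ψ'' : ℝ → E) (a b : ℝ) (hab : a ≤ b)
    (hψ : ∀ t ∈ Set.Icc a b, HasDerivAt ψ (ψ' t) t)
    (hψ' : ∀ t ∈ Set.Icc a b, HasDerivAt ψ' (ψ'' t) t)
    (hacc : ∀ t ∈ Set.Icc a b, ‖ψ'' t‖ ≤ M) :
    ‖ψ b - ψ a - (b - a) • ψ' a‖ ≤ M / 2 * (b - a) ^ 2 := by
  have h1 : ∀ t ∈ Set.Icc a b, ‖ψ' t - ψ' a‖ ≤ M * (t - a) :=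
    norm_image_sub_le_of_norm_deriv_le_segment'
      (fun t ht => (hψ' t ht).hasDerivWithinAt)
      (fun t ht => hacc t (Set.Ico_subset_Icc_self ht))
  have hd : ∀ t ∈ Set.Icc a b,
      HasDerivAt (fun t => ψ t - ψ a - (t - a) • ψ' a) (ψ' t - ψ' a) t := by
    intro t ht
    have h2 : HasDerivAt (fun t : ℝ => (t - a) • ψ' a) ((1 : ℝ) • ψ' a) t :=
      ((hasDerivAt_id t).sub_const a).smul_const (ψ' a)
    rw [one_smul] at h2
    exact ((hψ t ht).sub_const (ψ a)).sub h2
  have hB : ∀ t : ℝ, HasDerivAt (fun t : ℝ => M / 2 * (t - a) ^ 2) (M * (t - a)) t := by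
    intro t
    have h3 := ((((hasDerivAt_id t).sub_const a).pow 2).const_mul (M / 2))
    refine h3.congr_deriv ?_
    simp only [id]
    push_cast
    ring
  exact image_norm_le_of_norm_deriv_right_le_deriv_boundary
    (f := fun t => ψ t - ψ a - (t - a) • ψ' a) (f' := fun t => ψ' t - ψ' a)
    (fun t ht => (hd t ht).continuousAt.continuousWithinAt)
    (fun t ht => (hd t (Set.Ico_subset_Icc_self ht)).hasDerivWithinAt)
    (by simp) hB
    (fun t ht => h1 t (Set.Ico_subset_Icc_self ht)) ⟨hab, le_refl b⟩


/-- Global Euler discretization error bound for a time-dependent vector field that is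
Lipschitz in space, along a twice-differentiable solution trajectory with bounded
acceleration: `‖ψ 1 − x_K‖ ≤ (h/2) · ((exp L − 1)/L) · M`. -/
theorem euler_global_error_bound
    {E : Type*} [NormedAddCommGroup E] [NormedSpace ℝ E] [CompleteSpace E]
    (L M : ℝ) (hL : 0 < L) (hM : 0 ≤ M)
    (v : E → ℝ → E)
    (hlip : ∀ t ∈ Set.Icc (0:ℝ) 1, ∀ a b : E, ‖v a t - v b t‖ ≤ L * ‖a - b‖)
    (ψ ψ' ψ'' : ℝ → E)
    (hψ : ∀ t ∈ Set.Icc (0:ℝ) 1, HasDerivAt ψ (ψ' t) t)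
    (hψ' : ∀ t ∈ Set.Icc (0:ℝ) 1, HasDerivAt ψ' (ψ'' t) t)
    (hode : ∀ t ∈ Set.Icc (0:ℝ) 1, ψ' t = v (ψ t) t)
    (hacc : ∀ t ∈ Set.Icc (0:ℝ) 1, ‖ψ'' t‖ ≤ M)
    (K : ℕ) (hK : 1 ≤ K) (h : ℝ) (hh : h = 1 / K)
    (x : ℕ → E) (hx0 : x 0 = ψ 0)
    (hxk : ∀ k < K, x (k + 1) = x k + h • v (x k) ((k : ℝ) * h)) :
    ‖ψ 1 - x K‖ ≤ h / 2 * ((Real.exp L - 1) / L) * M := by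
  have hKpos : (0 : ℝ) < K := by exact_mod_cast hK
  have hpos : 0 < h := by rw [hh]; positivity
  have hKh : (K : ℝ) * h = 1 := by rw [hh]; field_simp
  have key : ∀ k : ℕ, k ≤ K →
      ‖ψ ((k : ℝ) * h) - x k‖ ≤ h / 2 * (((1 + h * L) ^ k - 1) / L) * M := by
    intro k
    induction k with
    | zero => intro _; simp [hx0]
    | succ k ih =>
      intro hk
      have ih := ih (by omega)
      have hkK : ((k : ℝ) + 1) ≤ K := by exact_mod_cast hk
      have ha0 : 0 ≤ (k : ℝ) * h := by positivity
      have hb1 : ((k : ℝ) + 1) * h ≤ 1 := by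
        exact (mul_le_mul_of_nonneg_right hkK hpos.le).trans hKh.le
      have hab : (k : ℝ) * h ≤ ((k : ℝ) + 1) * h := by nlinarith
      have hsub : ∀ t ∈ Set.Icc ((k : ℝ) * h) (((k : ℝ) + 1) * h), t ∈ Set.Icc (0 : ℝ) 1 :=
        fun t ht => ⟨ha0.trans ht.1, ht.2.trans hb1⟩
      have hloc := euler_local_error M ψ ψ' ψ'' _ _ hab
        (fun t ht => hψ t (hsub t ht)) (fun t ht => hψ' t (hsub t ht))
        (fun t ht => hacc t (hsub t ht))
      have hmem := hsub _ ⟨le_refl _, hab⟩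
      have hdiff : ((k : ℝ) + 1) * h - (k : ℝ) * h = h := by ring
      rw [hdiff, hode _ hmem] at hloc
      have hl := hlip _ hmem (ψ ((k : ℝ) * h)) (x k)
      push_cast
      rw [hxk k (by omega)]
      have heq : ψ (((k : ℝ) + 1) * h) - (x k + h • v (x k) ((k : ℝ) * h))
          = (ψ (((k : ℝ) + 1) * h) - ψ ((k : ℝ) * h)
              - h • v (ψ ((k : ℝ) * h)) ((k : ℝ) * h))
            + (ψ ((k : ℝ) * h) - x k)
            + h • (v (ψ ((k : ℝ) * h)) ((k : ℝ) * h) - v (x k) ((k : ℝ) * h)) := by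
        rw [smul_sub]; abel
      rw [heq]
      refine (norm_add₃_le).trans ?_
      rw [norm_smul, Real.norm_of_nonneg hpos.le]
      have h4 := mul_le_mul_of_nonneg_left hl hpos.le
      have h5 := mul_le_mul_of_nonneg_left ih (by positivity : 0 ≤ 1 + h * L)
      have h6 : h / 2 * (((1 + h * L) ^ (k + 1) - 1) / L) * M
          = M / 2 * h ^ 2 + (1 + h * L) * (h / 2 * (((1 + h * L) ^ k - 1) / L) * M) := by
        field_simp
        ring
      rw [h6]
      linarith
  have hfin := key K le_rfl
  rw [hKh] at hfin
  refine hfin.trans ?_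
  have hexp : (1 + h * L) ^ K ≤ Real.exp L := by
    calc (1 + h * L) ^ K ≤ (Real.exp (h * L)) ^ K := by
          apply pow_le_pow_left₀ (by positivity)
          linarith [Real.add_one_le_exp (h * L)]
      _ = Real.exp L := by
          rw [← Real.exp_nat_mul, ← mul_assoc, hKh, one_mul]
  gcongr
end

section
/- Let E be a real Banach space, let v : E → ℝ → ℝ → E be a scale-conditioned velocity field with arguments (x, t, α), fix x ∈ E and t ∈ ℝ, and suppose the map g : ℝ × ℝ → E, g(s, a) = v x s a, is Fréchet differentiable at (t, 1); write ∂_t v and ∂_α v for its partial derivatives at (t, 1) in the first and second argument. If the cross-scale consistency identity v x (t/α) α = α • v x t 1 holds for every α ∈ (0, 1], then the cross-scale coherence PDE holds at (x, t, 1): t • ∂_t v + v x t 1 = ∂_α v. -/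
/-- If the cross-scale consistency identity `v x (t/α) α = α • v x t 1` holds for all
`α ∈ (0,1]` and `g(s,a) = v x s a` is Fréchet differentiable at `(t,1)` with
derivative `D` (so `∂_t v = D (1,0)` and `∂_α v = D (0,1)`), then the cross-scale
coherence PDE `t • ∂_t v + v x t 1 = ∂_α v` holds at `(x, t, 1)`. -/
theorem cross_scale_coherence_pde
    {E : Type*} [NormedAddCommGroup E] [NormedSpace ℝ E]
    (v : E → ℝ → ℝ → E) (x : E) (t : ℝ)
    (D : ℝ × ℝ →L[ℝ] E)
    (hg : HasFDerivAt (fun p : ℝ × ℝ => v x p.1 p.2) D (t, 1))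
    (hcons : ∀ α ∈ Set.Ioc (0:ℝ) 1, v x (t / α) α = α • v x t 1) :
    t • D (1, 0) + v x t 1 = D (0, 1) := by
  have h1 : HasDerivAt (fun α : ℝ => (t / α, α)) (-t, (1:ℝ)) 1 := by
    have h := (hasDerivAt_inv (one_ne_zero (α := ℝ))).const_mul t
    have h2 : HasDerivAt (fun α : ℝ => t / α) (-t) 1 := by
      simpa [div_eq_mul_inv] using h
    exact h2.prodMk (hasDerivAt_id (1:ℝ))
  have hg' : HasFDerivAt (fun p : ℝ × ℝ => v x p.1 p.2) D (t / 1, 1) := by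
    simpa using hg
  have h3 : HasDerivWithinAt (fun α : ℝ => v x (t / α) α) (D (-t, 1)) (Set.Iic 1) 1 :=
    (HasFDerivAt.comp_hasDerivAt (1:ℝ) (f := fun α : ℝ => (t / α, α)) hg' h1).hasDerivWithinAt
  have h4 : HasDerivWithinAt (fun α : ℝ => α • v x t 1) (v x t 1) (Set.Iic 1) 1 := by
    simpa using ((hasDerivAt_id (1:ℝ)).smul_const (v x t 1)).hasDerivWithinAt
  have h5 : HasDerivWithinAt (fun α : ℝ => v x (t / α) α) (v x t 1) (Set.Iic 1) 1 := by
    refine h4.congr_of_eventuallyEq ?_ (by simp)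
    filter_upwards [self_mem_nhdsWithin,
      mem_nhdsWithin_of_mem_nhds (Ioi_mem_nhds (zero_lt_one (α := ℝ)))] with α ha hb
    exact hcons α ⟨hb, ha⟩
  have h6 : D (-t, 1) = v x t 1 := (uniqueDiffWithinAt_Iic (1:ℝ)).eq_deriv _ h3 h5
  have h7 : ((-t, 1) : ℝ × ℝ) = (0, 1) - t • (1, 0) := by ext <;> simp
  rw [← h6, h7, map_sub, map_smul]
  abel
end

section
/- Let E be a real Banach space, L ≥ 0, M ≥ 0, h ≥ 0, and t ∈ ℝ. Let v : E → ℝ → E be a time-dependent vector field such that x ↦ v x t is Lipschitz with constant L. Let ψ : ℝ → E be differentiable on [t, t + h] with ψ'(s) = v (ψ s) s for all s ∈ [t, t + h], and suppose ψ' is differentiable on [t, t + h] with ‖ψ''(s)‖ ≤ M for all s ∈ [t, t + h]. Then for every y ∈ E, one Euler step from y tracks the exact solution: ‖ψ(t + h) − (y + h • v y t)‖ ≤ (1 + h·L) · ‖ψ(t) − y‖ + (h²/2) · M. -/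
/-- One Euler step from an arbitrary state `y` tracks the exact solution:
`‖ψ(t+h) − (y + h • v y t)‖ ≤ (1 + h·L) · ‖ψ(t) − y‖ + (h²/2) · M`, where `L` is the
spatial Lipschitz constant of `v` at time `t` and `M` bounds the acceleration of `ψ`
on `[t, t+h]`. -/
theorem euler_step_tracks_solution
    {E : Type*} [NormedAddCommGroup E] [NormedSpace ℝ E] [CompleteSpace E]
    (L M h t : ℝ) (hL : 0 ≤ L) (hM : 0 ≤ M) (hh : 0 ≤ h)
    (v : E → ℝ → E)
    (hlip : ∀ a b : E, ‖v a t - v b t‖ ≤ L * ‖a - b‖)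
    (ψ ψ' ψ'' : ℝ → E)
    (hψ : ∀ s ∈ Set.Icc t (t + h), HasDerivAt ψ (ψ' s) s)
    (hode : ∀ s ∈ Set.Icc t (t + h), ψ' s = v (ψ s) s)
    (hψ' : ∀ s ∈ Set.Icc t (t + h), HasDerivAt ψ' (ψ'' s) s)
    (hacc : ∀ s ∈ Set.Icc t (t + h), ‖ψ'' s‖ ≤ M) :
    ∀ y : E, ‖ψ (t + h) - (y + h • v y t)‖ ≤
      (1 + h * L) * ‖ψ t - y‖ + h ^ 2 / 2 * M := by
  intro y
  have ht : t ∈ Set.Icc t (t + h) := ⟨le_refl t, by linarith⟩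
  have h1 : ∀ s ∈ Set.Icc t (t + h), ‖ψ' s - ψ' t‖ ≤ M * (s - t) :=
    norm_image_sub_le_of_norm_deriv_right_le_segment
      (fun s hs => (hψ' s hs).continuousAt.continuousWithinAt)
      (fun s hs => (hψ' s (Set.Ico_subset_Icc_self hs)).hasDerivWithinAt)
      (fun s hs => hacc s (Set.Ico_subset_Icc_self hs))
  have hg : ∀ s ∈ Set.Icc t (t + h),
      HasDerivAt (fun s => ψ s - ψ t - (s - t) • ψ' t) (ψ' s - ψ' t) s := by
    intro s hs
    have hd := ((hψ s hs).sub_const (ψ t)).sub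
      (((hasDerivAt_id s).sub_const t).smul_const (ψ' t))
    rw [one_smul] at hd
    exact hd
  have hB : ∀ s, HasDerivAt (fun s : ℝ => (s - t) ^ 2 / 2 * M) (M * (s - t)) s := by
    intro s
    have hd := ((((hasDerivAt_id s).sub_const t).pow 2).div_const 2).mul_const M
    refine HasDerivAt.congr_deriv (f := fun s : ℝ => (s - t) ^ 2 / 2 * M) hd ?_
    simp only [id]
    push_cast
    ring
  have h2 := image_norm_le_of_norm_deriv_right_le_deriv_boundary
    (f := fun s => ψ s - ψ t - (s - t) • ψ' t) (f' := fun s => ψ' s - ψ' t)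
    (a := t) (b := t + h)
    (fun s hs => (hg s hs).continuousAt.continuousWithinAt)
    (fun s hs => (hg s (Set.Ico_subset_Icc_self hs)).hasDerivWithinAt)
    (by simp) hB
    (fun s hs => h1 s (Set.Ico_subset_Icc_self hs))
    (Set.right_mem_Icc.2 (by linarith : t ≤ t + h))
  simp only [add_sub_cancel_left] at h2
  rw [hode t ht] at h2
  have e : ψ (t + h) - (y + h • v y t) =
      (ψ (t + h) - ψ t - h • v (ψ t) t) + (ψ t - y) + h • (v (ψ t) t - v y t) := by
    rw [smul_sub]
    abel
  have h3 : ‖h • (v (ψ t) t - v y t)‖ ≤ h * (L * ‖ψ t - y‖) := by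
    rw [norm_smul, Real.norm_of_nonneg hh]
    exact mul_le_mul_of_nonneg_left (hlip _ _) hh
  rw [e]
  refine (norm_add₃_le).trans ?_
  linarith
end
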